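/- arXiv:1211.2625 — 3 statements merged into one kernel-verified Lean document; each statement's English description precedes it below -/
import Mathlib

section
/- Let R be a factorial domain that is noetherian, let f_1,…,f_n, f ∈ R with some f_i ≠ 0, let d be a greatest common divisor of f_1,…,f_n, f, write h = f_1T_1+⋯+f_nT_n+f = d·h' with h' = f_1'T_1+⋯+f_n'T_n+f', and let d = p_1⋯p_k be a factorization of d into prime elements. Partition {1,…,k} = ⨄_{i∈I} J_i so that the sets ⋃_{j∈J_i} V(p_j) are the connected components of V(d) ⊆ Spec R. Then Spec R[T_1,…,T_n]/(h) is connected if and only if for every i ∈ I there exists some j ∈ J_i such that the ideal (h', p_j) of R[T_1,…,T_n] is not the unit ideal. -/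
open MvPolynomial

/-- The forcing equation `h = f_1T_1+⋯+f_nT_n+f₀` in `B = R[T_1,…,T_n]`. -/
noncomputable abbrev forcingPoly (R : Type*) [CommRing R] (n : ℕ) (f : Fin n → R) (f₀ : R) :
    MvPolynomial (Fin n) R :=
  (∑ i : Fin n, C (f i) * X i) + C f₀

/-- The horizontal prime `𝔭 = B ∩ (h)·Q(R)[T_1,…,T_n]`, i.e. the contraction to
`B = R[T_1,…,T_n]` of the ideal generated by `h` in `Q(R)[T_1,…,T_n]`. -/
noncomputable abbrev horizontalPrime (R : Type*) [CommRing R] [IsDomain R]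
    (n : ℕ) (f : Fin n → R) (f₀ : R) : Ideal (MvPolynomial (Fin n) R) :=
  Ideal.comap (MvPolynomial.map (algebraMap R (FractionRing R)))
    (Ideal.span {MvPolynomial.map (algebraMap R (FractionRing R)) (forcingPoly R n f f₀)})

theorem ffa_irred_zeroLocus {A : Type*} [CommRing A] {q : A} (hq : Prime q) :
    IsIrreducible (PrimeSpectrum.zeroLocus ({q} : Set A)) := by
  have hP : (Ideal.span ({q} : Set A)).IsPrime :=
    (Ideal.span_singleton_prime hq.ne_zero).2 hq
  rw [← PrimeSpectrum.zeroLocus_span]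
  exact (PrimeSpectrum.isIrreducible_zeroLocus_iff_of_radical _ hP.isRadical).2 hP

theorem ffa_connected_iff {A : Type*} [CommRing A] (q : A) :
    ConnectedSpace (PrimeSpectrum (A ⧸ Ideal.span {q})) ↔
      IsConnected (PrimeSpectrum.zeroLocus ({q} : Set A)) := by
  have hs : Function.Surjective (Ideal.Quotient.mk (Ideal.span {q})) :=
    Ideal.Quotient.mk_surjective
  have hr := range_comap_of_surjective _ _ hs
  rw [Ideal.mk_ker, PrimeSpectrum.zeroLocus_span] at hr
  have he := PrimeSpectrum.isEmbedding_comap_of_surjective _ _ hs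
  rw [← hr, ← Set.image_univ, connectedSpace_iff_univ]
  unfold IsConnected
  rw [he.isInducing.isPreconnected_image, Set.image_nonempty]

theorem ffa_coeff_zero (R : Type*) [CommRing R] (n : ℕ) (f : Fin n → R) (f₀ : R) :
    coeff 0 (forcingPoly R n f f₀) = f₀ := by
  simp [forcingPoly, coeff_sum, coeff_C_mul]

theorem ffa_coeff_single (R : Type*) [CommRing R] (n : ℕ) (f : Fin n → R) (f₀ : R) (i : Fin n) :
    coeff (Finsupp.single i 1) (forcingPoly R n f f₀) = f i := by
  classical
  have : (0 : Fin n →₀ ℕ) ≠ Finsupp.single i 1 := by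
    intro h
    have := DFunLike.congr_fun h i
    simp at this
  simp [forcingPoly, coeff_sum, coeff_C_mul, coeff_X, coeff_C, this, Finsupp.single_left_inj]

theorem ffa_prime (R : Type*) [CommRing R] [IsDomain R] [UniqueFactorizationMonoid R]
    (n : ℕ) (f : Fin n → R) (f₀ : R) (hf : ∃ i, f i ≠ 0)
    (hu : ∀ e : R, (∀ i, e ∣ f i) → e ∣ f₀ → IsUnit e) :
    Prime (forcingPoly R n f f₀) := by
  rw [← UniqueFactorizationMonoid.irreducible_iff_prime]
  apply irreducible_of_totalDegree_eq_one
  · apply le_antisymm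
    · refine (totalDegree_add _ _).trans (max_le ?_ (by simp))
      apply totalDegree_finsetSum_le
      intro i _
      refine (totalDegree_mul _ _).trans ?_
      simp
    · obtain ⟨i, hi⟩ := hf
      rw [← ffa_coeff_single R n f f₀ i] at hi
      have := le_totalDegree (mem_support_iff.2 hi)
      simpa using this
  · intro x hx
    apply hu
    · intro i
      rw [← ffa_coeff_single R n f f₀ i]
      exact hx _
    · have := hx 0
      rwa [ffa_coeff_zero] at this

/-- Corollary `factorialconnected`: Let `R` be a noetherian factorial
domain, `f_1,…,f_n,f₀ ∈ R` with some `f_i ≠ 0`, `d` a gcd of the `f_i` and `f₀`, write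
`h = d·h'` with `h' = f_1'T_1+⋯+f_n'T_n+f₀'`, and let `d = p_1⋯p_k` be a prime
factorization. Partition `{1,…,k} = ⨄_{i} J_i` so that the sets `⋃_{j∈J_i} V(p_j)` are
the connected components of `V(d) ⊆ Spec R`. Then `Spec R[T]/(h)` is connected iff for
every `i` there is `j ∈ J_i` with `(h', p_j) ≠ (1)`. -/
theorem factorial_forcing_algebra_connected_iff
    (R : Type*) [CommRing R] [IsDomain R] [IsNoetherianRing R]
    [UniqueFactorizationMonoid R]
    (n : ℕ) (f f' : Fin n → R) (f₀ f₀' d : R) (hf : ∃ i, f i ≠ 0)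
    (hdvd : ∀ i, f i = d * f' i) (hdvd₀ : f₀ = d * f₀')
    (hgcd : ∀ e : R, (∀ i, e ∣ f i) → e ∣ f₀ → e ∣ d)
    (k : ℕ) (p : Fin k → R) (hp : ∀ j, Prime (p j)) (hdfact : d = ∏ j : Fin k, p j)
    (ι : Type*) (J : ι → Set (Fin k))
    (hpart : ∀ j : Fin k, ∃! i : ι, j ∈ J i)
    (hcomp : ∀ i : ι, ∃ x ∈ ⋃ j ∈ J i, PrimeSpectrum.zeroLocus ({p j} : Set R),
      (⋃ j ∈ J i, PrimeSpectrum.zeroLocus ({p j} : Set R)) =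
        connectedComponentIn (PrimeSpectrum.zeroLocus ({d} : Set R)) x) :
    ConnectedSpace
        (PrimeSpectrum (MvPolynomial (Fin n) R ⧸ Ideal.span {forcingPoly R n f f₀})) ↔
      ∀ i : ι, ∃ j ∈ J i,
        Ideal.span {forcingPoly R n f' f₀', (C (p j) : MvPolynomial (Fin n) R)} ≠ ⊤ := by
  classical
  have hd0 : d ≠ 0 := by
    rintro rfl
    obtain ⟨i, hi⟩ := hf
    exact hi (by simp [hdvd i])
  have hprime : Prime (forcingPoly R n f' f₀') := by
    apply ffa_prime
    · obtain ⟨i, hi⟩ := hf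
      exact ⟨i, fun h => hi (by simp [hdvd i, h])⟩
    · intro e he he0
      have : d * e ∣ d * 1 := by
        rw [mul_one]
        apply hgcd
        · intro i
          rw [hdvd i]
          exact mul_dvd_mul_left _ (he i)
        · rw [hdvd₀]
          exact mul_dvd_mul_left _ he0
      exact isUnit_of_dvd_one ((mul_dvd_mul_iff_left hd0).1 this)
  have hh : forcingPoly R n f f₀ = C d * forcingPoly R n f' f₀' := by
    simp only [forcingPoly, hdvd, hdvd₀, map_mul, mul_add, Finset.mul_sum, mul_assoc]
  have hCp : ∀ j, Prime (C (p j) : MvPolynomial (Fin n) R) := fun j =>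
    (prime_C_iff (Fin n)).2 (hp j)
  rw [ffa_connected_iff]
  generalize hH : forcingPoly R n f' f₀' = h' at *
  rw [hh]
  have hpd : ∀ j, p j ∣ d := fun j => hdfact ▸ Finset.dvd_prod_of_mem p (Finset.mem_univ j)
  have hVh : ∀ y : PrimeSpectrum (MvPolynomial (Fin n) R),
      y ∈ PrimeSpectrum.zeroLocus {C d * h'} ↔ (∃ j, C (p j) ∈ y.asIdeal) ∨ h' ∈ y.asIdeal := by
    intro y
    simp only [PrimeSpectrum.mem_zeroLocus, Set.singleton_subset_iff, SetLike.mem_coe,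
      y.2.mul_mem_iff_mem_or_mem]
    rw [hdfact, map_prod, y.2.prod_mem_iff]
    simp
  have hVd : ∀ y : PrimeSpectrum R,
      y ∈ PrimeSpectrum.zeroLocus {d} ↔ ∃ j, p j ∈ y.asIdeal := by
    intro y
    simp only [PrimeSpectrum.mem_zeroLocus, Set.singleton_subset_iff, SetLike.mem_coe]
    rw [hdfact, y.2.prod_mem_iff]
    simp
  have hsub : ∀ j, PrimeSpectrum.zeroLocus ({p j} : Set R) ⊆ PrimeSpectrum.zeroLocus {d} := by
    intro j y hy
    exact (hVd y).2 ⟨j, by simpa using hy⟩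
  constructor
  · intro hconn i
    by_contra! hcon
    have hdis : ∀ y : PrimeSpectrum (MvPolynomial (Fin n) R), ∀ j ∈ J i,
        C (p j) ∈ y.asIdeal → h' ∉ y.asIdeal := by
      intro y j hj h1 h2
      apply y.2.ne_top
      rw [eq_top_iff, ← hcon j hj, Ideal.span_le]
      rintro z (rfl | rfl)
      · exact h2
      · exact h1
    obtain ⟨x, hx, hZ⟩ := hcomp i
    have key : ∀ (P Q : PrimeSpectrum R) (j j' : Fin k), j ∈ J i → p j ∈ P.asIdeal →
        p j' ∈ P.asIdeal → p j' ∈ Q.asIdeal → ∃ l ∈ J i, p l ∈ Q.asIdeal := by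
      intro P Q j j' hj h1 h2 h3
      have hP : P ∈ connectedComponentIn (PrimeSpectrum.zeroLocus ({d} : Set R)) x := by
        rw [← hZ]
        simp only [Set.mem_iUnion]
        exact ⟨j, hj, by simpa using h1⟩
      have := (ffa_irred_zeroLocus (hp j')).isConnected.isPreconnected.subset_connectedComponentIn
        (x := P) (by simpa using h2) (hsub j')
      rw [← connectedComponentIn_eq hP, ← hZ] at this
      have hQ := this (show Q ∈ _ by simpa using h3)
      simp only [Set.mem_iUnion] at hQ
      obtain ⟨l, hl, hl'⟩ := hQ
      exact ⟨l, hl, by simpa using hl'⟩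
    let S : Set (Fin k) := {j | ∀ P : PrimeSpectrum R, p j ∈ P.asIdeal → ∀ l ∈ J i, p l ∉ P.asIdeal}
    have hcl := isPreconnected_closed_iff.1 hconn.isPreconnected
      (⋃ j ∈ J i, PrimeSpectrum.zeroLocus {C (p j)})
      (PrimeSpectrum.zeroLocus {h'} ∪ ⋃ j ∈ S, PrimeSpectrum.zeroLocus {C (p j)})
      ((Set.toFinite _).isClosed_biUnion fun j _ => PrimeSpectrum.isClosed_zeroLocus _)
      ((PrimeSpectrum.isClosed_zeroLocus _).union
        ((Set.toFinite _).isClosed_biUnion fun j _ => PrimeSpectrum.isClosed_zeroLocus _))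
      ?_ ?_ ?_
    · obtain ⟨y, -, hy1, hy2⟩ := hcl
      simp only [Set.mem_iUnion, Set.mem_union, PrimeSpectrum.mem_zeroLocus,
        Set.singleton_subset_iff, SetLike.mem_coe, exists_prop] at hy1 hy2
      obtain ⟨j, hj, hjy⟩ := hy1
      rcases hy2 with hy2 | ⟨l, hl, hly⟩
      · exact hdis y j hj hjy hy2
      · exact hl (PrimeSpectrum.comap C y) hly j hj hjy
    · intro y hy
      simp only [Set.mem_iUnion, Set.mem_union, PrimeSpectrum.mem_zeroLocus,
        Set.singleton_subset_iff, SetLike.mem_coe, exists_prop]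
      rcases (hVh y).1 hy with ⟨j, hj⟩ | hy
      · by_cases hjS : j ∈ S
        · exact Or.inr (Or.inr ⟨j, hjS, hj⟩)
        · left
          simp only [S, Set.mem_ofPred_eq] at hjS
          push Not at hjS
          obtain ⟨P, hP, l, hl, hlP⟩ := hjS
          exact key P (PrimeSpectrum.comap C y) l j hl hlP hP hj
      · exact Or.inr (Or.inl hy)
    · simp only [Set.mem_iUnion] at hx
      obtain ⟨j, hj, -⟩ := hx
      obtain ⟨y, hy⟩ := (ffa_irred_zeroLocus (hCp j)).nonempty
      refine ⟨y, (hVh y).2 (Or.inl ⟨j, by simpa using hy⟩), ?_⟩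
      simp only [Set.mem_iUnion]
      exact ⟨j, hj, hy⟩
    · obtain ⟨y, hy⟩ := (ffa_irred_zeroLocus hprime).nonempty
      exact ⟨y, (hVh y).2 (Or.inr (by simpa using hy)), Or.inl hy⟩
  · intro hall
    obtain ⟨x0, hx0⟩ := (ffa_irred_zeroLocus hprime).nonempty
    have hsub' : PrimeSpectrum.zeroLocus {h'} ⊆ PrimeSpectrum.zeroLocus {C d * h'} := by
      intro y hy
      exact (hVh y).2 (Or.inr (by simpa using hy))
    have hsubp : ∀ j, PrimeSpectrum.zeroLocus {C (p j)} ⊆ PrimeSpectrum.zeroLocus {C d * h'} := by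
      intro j y hy
      exact (hVh y).2 (Or.inl ⟨j, by simpa using hy⟩)
    refine ⟨⟨x0, hsub' hx0⟩, isPreconnected_of_forall x0 ?_⟩
    intro y hy
    rcases (hVh y).1 hy with ⟨j, hj⟩ | hy'
    · obtain ⟨i, hi, -⟩ := hpart j
      obtain ⟨l, hl, hne⟩ := hall i
      obtain ⟨x, -, hZ⟩ := hcomp i
      obtain ⟨M, hM, hle⟩ := Ideal.exists_le_maximal _ hne
      let s : PrimeSpectrum R → PrimeSpectrum (MvPolynomial (Fin n) R) :=
        PrimeSpectrum.comap constantCoeff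
      have hs : Continuous s := PrimeSpectrum.continuous_comap _
      have hsmem : ∀ (P : PrimeSpectrum R) (r : R), C r ∈ (s P).asIdeal ↔ r ∈ P.asIdeal := by
        intro P r
        simp [s]
      have hZc : IsPreconnected (⋃ j ∈ J i, PrimeSpectrum.zeroLocus ({p j} : Set R)) := by
        rw [hZ]
        exact isPreconnected_connectedComponentIn
      have hmem : ∀ j ∈ J i, ∃ P ∈ (⋃ j ∈ J i, PrimeSpectrum.zeroLocus ({p j} : Set R)),
          s P ∈ PrimeSpectrum.zeroLocus {C (p j)} := by
        intro j hj
        obtain ⟨P, hP⟩ := (ffa_irred_zeroLocus (hp j)).nonempty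
        refine ⟨P, ?_, ?_⟩
        · simp only [Set.mem_iUnion]
          exact ⟨j, hj, hP⟩
        · have : p j ∈ P.asIdeal := by simpa using hP
          simpa using (hsmem P (p j)).2 this
      obtain ⟨P, hP, hsP⟩ := hmem j hi
      obtain ⟨P', hP', hsP'⟩ := hmem l hl
      let z : PrimeSpectrum (MvPolynomial (Fin n) R) := ⟨M, hM.isPrime⟩
      have hz1 : z ∈ PrimeSpectrum.zeroLocus {h'} := by
        simpa using hle (Ideal.subset_span (by simp))
      have hz2 : z ∈ PrimeSpectrum.zeroLocus {C (p l)} := by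
        simpa using hle (Ideal.subset_span (by simp))
      have c1 := (ffa_irred_zeroLocus hprime).isConnected.isPreconnected.union z hz1 hz2
        (ffa_irred_zeroLocus (hCp l)).isConnected.isPreconnected
      have c2 := c1.union (s P') (Or.inr hsP') (Set.mem_image_of_mem s hP')
        (hZc.image s hs.continuousOn)
      have c3 := c2.union (s P) (Or.inr (Set.mem_image_of_mem s hP)) hsP
        (ffa_irred_zeroLocus (hCp j)).isConnected.isPreconnected
      refine ⟨_, ?_, ?_, ?_, c3⟩
      · refine Set.union_subset (Set.union_subset (Set.union_subset hsub' (hsubp l)) ?_) (hsubp j)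
        rintro _ ⟨Q, hQ, rfl⟩
        simp only [Set.mem_iUnion] at hQ
        obtain ⟨m, -, hm⟩ := hQ
        exact (hVh _).2 (Or.inl ⟨m, (hsmem Q (p m)).2 (by simpa using hm)⟩)
      · exact Or.inl (Or.inl (Or.inl hx0))
      · exact Or.inr (by simpa using hj)
    · exact ⟨_, hsub', hx0, by simpa using hy',
        (ffa_irred_zeroLocus hprime).isConnected.isPreconnected⟩
end

section
/- Let R be a Dedekind domain (a normal noetherian domain of Krull dimension 1), let f_1,…,f_n ∈ R generate the ideal I = (f_1,…,f_n), let f ∈ R lie in the radical of I, and let A = R[T_1,…,T_n]/(f_1T_1+⋯+f_nT_n+f) be the forcing algebra. Then the following are equivalent: (1) Spec A is connected; (2) for every prime ideal 𝔭 of R the spectrum Spec A_{R∖𝔭} is connected; (3) f ∈ I. -/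
open MvPolynomial

/-- A ring with a "contraction" to a domain has connected spectrum. -/
theorem conn_of_contraction {B R' : Type*} [CommRing B] [CommRing R'] [IsDomain R']
    (σ : B →+* R') (ι : R' →+* B) (φ : B →+* Polynomial B)
    (h1 : ∀ b, (φ b).eval 1 = b) (h0 : ∀ b, (φ b).eval 0 = ι (σ b)) :
    ConnectedSpace (PrimeSpectrum B) := by
  have key : ∀ e : B, IsIdempotentElem e → σ e = 0 → e = 0 := by
    intro e he hs
    have hX : Polynomial.X ∣ φ e := by
      rw [Polynomial.X_dvd_iff, Polynomial.coeff_zero_eq_eval_zero, h0, hs, map_zero]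
    have hp : φ e = 0 := by
      ext d
      have : φ e = (φ e) ^ (d + 1) := by
        rw [← map_pow, he.pow_succ_eq]
      have hd : (Polynomial.X : Polynomial B) ^ (d + 1) ∣ φ e := by
        rw [this]; exact pow_dvd_pow_of_dvd hX _
      rw [Polynomial.X_pow_dvd_iff] at hd
      simpa using hd d (Nat.lt_succ_self d)
    rw [← h1 e, hp, Polynomial.eval_zero]
  have : Nontrivial B := σ.domain_nontrivial
  have hne : Nonempty (PrimeSpectrum B) := inferInstance
  have hpre : PreconnectedSpace (PrimeSpectrum B) := by
    rw [preconnectedSpace_iff_clopen]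
    intro s hs
    obtain ⟨e, he, rfl⟩ := PrimeSpectrum.isClopen_iff.mp hs
    have hse : IsIdempotentElem (σ e) := he.map σ
    rcases IsIdempotentElem.iff_eq_zero_or_one.mp hse with h | h
    · left
      rw [key e he h]; simp
    · right
      have := key (1 - e) he.one_sub (by simp [h])
      rw [← sub_eq_zero.mp this]; simp
  exact { toPreconnectedSpace := hpre, toNonempty := hne }

theorem not_conn_of_split {R B K L : Type*} [CommRing R] [CommRing B] [Field K] [Field L]
    {n : ℕ} (f : Fin n → R) (f₀ : R) (j : R →+* B) (T : Fin n → B)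
    (hT : ∑ i, j (f i) * T i + j f₀ = 0) (p : Ideal R) [p.IsMaximal] (hp : p ≠ ⊥)
    (c : R) (hc : c ∉ p) (g : Fin n → R) (hg : ∀ i, g i ∈ p) (hcf : ∀ i, c * f i = f₀ * g i)
    (N : ℕ) (J : Ideal R) (hJ : Ideal.span {f₀} = p ^ N * J) (hcJ : c ∈ J)
    (α : B →+* K) (hα : Function.Injective (α.comp j))
    (β : B →+* L) (hβ : ∀ a ∈ p, β (j a) = 0) :
    ¬ ConnectedSpace (PrimeSpectrum B) := by
  intro hconn
  set w : B := ∑ i, j (g i) * T i + j c with hw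
  have hfw : j f₀ * w = 0 := by
    have : j f₀ * w = j c * (∑ i, j (f i) * T i + j f₀) := by
      rw [hw, mul_add, mul_add, Finset.mul_sum, Finset.mul_sum, mul_comm (j f₀) (j c)]
      congr 1
      refine Finset.sum_congr rfl fun i _ => ?_
      rw [← mul_assoc, ← mul_assoc, ← map_mul, ← map_mul, hcf]
    rw [this, hT, mul_zero]
  have hset : PrimeSpectrum.zeroLocus (Set.image j (p : Set R)) =
      (PrimeSpectrum.basicOpen (w * j c) : Set (PrimeSpectrum B)) := by
    ext q
    simp only [PrimeSpectrum.mem_zeroLocus, Set.image_subset_iff, SetLike.mem_coe,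
      PrimeSpectrum.mem_basicOpen]
    constructor
    · intro hq hmem
      have hpq : p ≤ q.asIdeal.comap j := hq
      have heq : p = q.asIdeal.comap j :=
        Ideal.IsMaximal.eq_of_le ‹_› (Ideal.IsPrime.ne_top inferInstance) hpq
      have hjc : j c ∈ q.asIdeal := by
        rcases q.isPrime.mem_or_mem hmem with h | h
        · rw [hw] at h
          refine (Ideal.add_mem_iff_right _ ?_).mp h
          exact Ideal.sum_mem _ fun i _ => Ideal.mul_mem_right _ _ (hpq (hg i))
        · exact h
      exact hc (heq ▸ hjc)
    · intro hq
      have hwq : w ∉ q.asIdeal := fun h => hq (Ideal.mul_mem_right _ _ h)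
      have hcq : j c ∉ q.asIdeal := fun h => hq (Ideal.mul_mem_left _ _ h)
      have hf : j f₀ ∈ q.asIdeal :=
        (q.isPrime.mem_or_mem (hfw ▸ q.asIdeal.zero_mem)).resolve_right hwq
      have hle : p ^ N * J ≤ q.asIdeal.comap j := by
        rw [← hJ, Ideal.span_singleton_le_iff_mem]; exact hf
      have hprime : (q.asIdeal.comap j).IsPrime := inferInstance
      rcases hprime.mul_le.mp hle with h | h
      · exact hprime.le_of_pow_le h
      · exact absurd (h hcJ) hcq
  have hclopen : IsClopen (PrimeSpectrum.zeroLocus (Set.image j (p : Set R))) := by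
    refine ⟨PrimeSpectrum.isClosed_zeroLocus _, ?_⟩
    rw [hset]; exact (PrimeSpectrum.basicOpen _).2
  have huniv := hclopen.eq_univ ⟨⟨RingHom.ker β, RingHom.ker_isPrime β⟩, by
    rintro _ ⟨a, ha, rfl⟩
    exact hβ a ha⟩
  obtain ⟨a, ha, ha0⟩ := Submodule.exists_mem_ne_zero_of_ne_bot hp
  have hmem : (⟨RingHom.ker α, RingHom.ker_isPrime α⟩ : PrimeSpectrum B) ∈
    PrimeSpectrum.zeroLocus (Set.image j (p : Set R)) := huniv ▸ Set.mem_univ _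
  have : α (j a) = 0 := hmem ⟨a, ha, rfl⟩
  exact ha0 (hα (by simpa using this))

theorem dedekind_split_data {R : Type*} [CommRing R] [IsDedekindDomain R]
    {n : ℕ} (f : Fin n → R) (f₀ : R)
    (hrad : f₀ ∈ (Ideal.span (Set.range f)).radical) (hf : f₀ ∉ Ideal.span (Set.range f)) :
    ∃ p : Ideal R, p.IsMaximal ∧ p ≠ ⊥ ∧ Ideal.span (Set.range f) ≤ p ∧ f₀ ∈ p ∧
      ∃ c ∉ p, ∃ g : Fin n → R, (∀ i, g i ∈ p) ∧ (∀ i, c * f i = f₀ * g i) ∧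
      ∃ (N : ℕ) (J : Ideal R), Ideal.span {f₀} = p ^ N * J ∧ c ∈ J := by
  set I := Ideal.span (Set.range f) with hI
  have hf0 : f₀ ≠ 0 := fun h => hf (h ▸ I.zero_mem)
  have hI0 : I ≠ ⊥ := by
    intro h
    obtain ⟨k, hk⟩ := hrad
    rw [h, Ideal.mem_bot] at hk
    exact hf0 (eq_zero_of_pow_eq_zero hk)
  let Q : Ideal R := I.colon {f₀}
  have hQmem : ∀ x, x ∈ Q ↔ x * f₀ ∈ I := fun x => by
    simp [Q, Submodule.mem_colon_singleton]
  have hQ : Q ≠ ⊤ := by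
    rw [Ne, Ideal.eq_top_iff_one, hQmem, one_mul]; exact hf
  obtain ⟨p, hpm, hQp⟩ := Ideal.exists_le_maximal Q hQ
  have hIp : I ≤ p := fun x hx => hQp ((hQmem x).2 (I.mul_mem_right _ hx))
  have hf0p : f₀ ∈ p := by
    obtain ⟨k, hk⟩ := hrad
    exact hpm.isPrime.mem_of_pow_mem k (hIp hk)
  refine ⟨p, hpm, fun h => hI0 (le_bot_iff.mp (h ▸ hIp)), hIp, hf0p, ?_⟩
  obtain ⟨J, hJ, hJ'⟩ := Ideal.eq_prime_pow_mul_coprime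
    (I := Ideal.span {f₀}) (by simpa using hf0) p
  obtain ⟨I', hI1, hI2⟩ := Ideal.eq_prime_pow_mul_coprime hI0 p
  generalize Multiset.count p _ = m at hJ'
  generalize Multiset.count p _ = k at hI2
  have hnle : ∀ L : Ideal R, p ⊔ L = ⊤ → ∃ x ∈ L, x ∉ p := by
    intro L hL
    by_contra! h
    have : L ≤ p := h
    rw [sup_eq_left.mpr this] at hL
    exact hpm.ne_top hL
  obtain ⟨c, hcJ, hcp⟩ := hnle J hJ
  obtain ⟨d, hdI, hdp⟩ := hnle I' hI1
  have hmk : m < k := by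
    by_contra! hkm
    apply hdp
    apply hQp
    rw [hQmem, mul_comm, hI2]
    refine Ideal.mul_mem_mul ?_ hdI
    have : f₀ ∈ p ^ m * J := hJ' ▸ Ideal.mem_span_singleton_self f₀
    exact Ideal.pow_le_pow_right hkm ((Ideal.mul_le_left : _ * _ ≤ _) this)
  have hex : ∀ i, ∃ g ∈ p, c * f i = f₀ * g := by
    intro i
    have h1 : f i ∈ p ^ (m + 1) := by
      have : f i ∈ I := Ideal.subset_span ⟨i, rfl⟩
      rw [hI2] at this
      exact Ideal.pow_le_pow_right hmk ((Ideal.mul_le_left : _ * _ ≤ _) this)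
    have h2 : f i * c ∈ p ^ (m + 1) * J := Ideal.mul_mem_mul h1 hcJ
    rw [pow_succ, mul_right_comm, ← hJ', Ideal.mem_span_singleton_mul] at h2
    obtain ⟨z, hz, h⟩ := h2
    exact ⟨z, hz, by rw [h, mul_comm]⟩
  choose g hg hcf using hex
  exact ⟨c, hcp, g, hg, hcf, m, J, hJ', hcJ⟩

/-- The homomorphism out of the forcing algebra given by a solution. -/
noncomputable def forcingLift {R S : Type*} [CommRing R] [CommRing S] {n : ℕ}
    (f : Fin n → R) (f₀ : R) (j : R →+* S) (s : Fin n → S)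
    (h : ∑ i, j (f i) * s i + j f₀ = 0) :
    (MvPolynomial (Fin n) R ⧸ Ideal.span {forcingPoly R n f f₀}) →+* S :=
  Ideal.Quotient.lift _ (MvPolynomial.eval₂Hom j s) (by
    intro a ha
    rw [← RingHom.mem_ker]
    revert a
    change Ideal.span _ ≤ _
    rw [Ideal.span_singleton_le_iff_mem, RingHom.mem_ker]
    simpa [forcingPoly] using h)

theorem forcingLift_algebraMap {R S : Type*} [CommRing R] [CommRing S] {n : ℕ}
    (f : Fin n → R) (f₀ : R) (j : R →+* S) (s : Fin n → S)
    (h : ∑ i, j (f i) * s i + j f₀ = 0) (r : R) :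
    forcingLift f f₀ j s h (algebraMap R _ r) = j r := by
  change MvPolynomial.eval₂Hom j s (C r) = j r
  simp

theorem forcingLift_X {R S : Type*} [CommRing R] [CommRing S] {n : ℕ}
    (f : Fin n → R) (f₀ : R) (j : R →+* S) (s : Fin n → S)
    (h : ∑ i, j (f i) * s i + j f₀ = 0) (i : Fin n) :
    forcingLift f f₀ j s h (Ideal.Quotient.mk _ (X i)) = s i := by
  change MvPolynomial.eval₂Hom j s (X i) = s i
  simp

theorem forcing_hom_ext {R S : Type*} [CommRing R] [CommRing S] {n : ℕ}
    {f : Fin n → R} {f₀ : R}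
    {a b : (MvPolynomial (Fin n) R ⧸ Ideal.span {forcingPoly R n f f₀}) →+* S}
    (h1 : ∀ r, a (algebraMap R _ r) = b (algebraMap R _ r))
    (h2 : ∀ i, a (Ideal.Quotient.mk _ (X i)) = b (Ideal.Quotient.mk _ (X i))) : a = b := by
  apply Ideal.Quotient.ringHom_ext
  apply MvPolynomial.ringHom_ext
  · exact h1
  · exact h2

theorem forcing_rel {R : Type*} [CommRing R] {n : ℕ} (f : Fin n → R) (f₀ : R) :
    ∑ i, algebraMap R (MvPolynomial (Fin n) R ⧸ Ideal.span {forcingPoly R n f f₀}) (f i) *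
      Ideal.Quotient.mk _ (X i) + algebraMap R _ f₀ = 0 := by
  have : Ideal.Quotient.mk (Ideal.span {forcingPoly R n f f₀}) (forcingPoly R n f f₀) = 0 :=
    Ideal.Quotient.eq_zero_iff_mem.mpr (Ideal.mem_span_singleton_self _)
  rw [forcingPoly, map_add, map_sum] at this
  simp only [map_mul] at this
  exact this

theorem map_combination {R A : Type*} [CommRing R] [CommRing A] {n : ℕ} (f : Fin n → R) (f₀ : R)
    (a : Fin n → R) (j : R →+* A) (ha : ∑ i, a i * f i = f₀) :
    ∑ i, j (f i) * j (a i) = j f₀ := by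
  rw [← ha, map_sum]
  exact Finset.sum_congr rfl fun i _ => by rw [map_mul, mul_comm]

theorem contraction_rel {R A : Type*} [CommRing R] [CommRing A] {n : ℕ} (f : Fin n → R) (f₀ : R)
    (a : Fin n → R) (j : R →+* A) (t : Fin n → A)
    (hja : ∑ i, j (f i) * j (a i) = j f₀) (hrel : ∑ i, j (f i) * t i + j f₀ = 0) :
    ∑ i, (Polynomial.C.comp j) (f i) *
      (-Polynomial.C (j (a i)) + Polynomial.X * Polynomial.C (t i + j (a i))) +
      (Polynomial.C.comp j) f₀ = 0 := by
  have e1 : ∀ i, (Polynomial.C.comp j) (f i) *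
    (-Polynomial.C (j (a i)) + Polynomial.X * Polynomial.C (t i + j (a i))) =
    - Polynomial.C (j (f i) * j (a i)) +
    Polynomial.X * Polynomial.C (j (f i) * t i + j (f i) * j (a i)) := by
    intro i
    simp only [RingHom.comp_apply, map_add, map_mul]
    ring
  have e2 : ∑ i, (- Polynomial.C (j (f i) * j (a i)) +
      Polynomial.X * Polynomial.C (j (f i) * t i + j (f i) * j (a i))) =
      - Polynomial.C (∑ i, j (f i) * j (a i)) +
      Polynomial.X * Polynomial.C (∑ i, j (f i) * t i + ∑ i, j (f i) * j (a i)) := by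
    rw [Finset.sum_add_distrib, Finset.sum_neg_distrib, ← Finset.mul_sum,
      ← Finset.sum_add_distrib, map_sum Polynomial.C, map_sum Polynomial.C]
  rw [Finset.sum_congr rfl fun i _ => e1 i, e2, hja, hrel]
  simp

/-- The contraction data on a ring with the universal property of the forcing algebra. -/
theorem abstract_contraction.{u} {R A : Type u} [CommRing R] [CommRing A] [Algebra R A] {n : ℕ}
    (f : Fin n → R) (f₀ : R) (hf : f₀ ∈ Ideal.span (Set.range f)) (t : Fin n → A)
    (hrel : ∑ i, algebraMap R A (f i) * t i + algebraMap R A f₀ = 0)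
    (hlift : ∀ (S : Type u) [CommRing S] (j : R →+* S) (s : Fin n → S),
      ∑ i, j (f i) * s i + j f₀ = 0 →
      ∃ φ : A →+* S, (∀ r, φ (algebraMap R A r) = j r) ∧ ∀ i, φ (t i) = s i)
    (hext : ∀ (S : Type u) [CommRing S] (a b : A →+* S),
      (∀ r, a (algebraMap R A r) = b (algebraMap R A r)) → (∀ i, a (t i) = b (t i)) → a = b) :
    ∃ (σ : A →+* R) (φ : A →+* Polynomial A),
      (∀ r, σ (algebraMap R _ r) = r) ∧
      (∀ r, φ (algebraMap R _ r) = Polynomial.C (algebraMap R _ r)) ∧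
      (∀ b, (φ b).eval 1 = b) ∧ (∀ b, (φ b).eval 0 = algebraMap R _ (σ b)) := by
  obtain ⟨a, ha⟩ := (Ideal.mem_span_range_iff_exists_fun).mp hf
  have hja := map_combination f f₀ a (algebraMap R A) ha
  have hσ : ∑ i, RingHom.id R (f i) * (-a i) + RingHom.id R f₀ = 0 := by
    simp only [RingHom.id_apply, mul_neg, Finset.sum_neg_distrib]
    rw [← ha, neg_add_eq_zero]
    exact Finset.sum_congr rfl fun i _ => mul_comm _ _
  obtain ⟨σ, hσ1, hσ2⟩ := hlift R _ _ hσ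
  obtain ⟨φ, hφ1, hφ2⟩ := hlift (Polynomial A) _ _
    (contraction_rel f f₀ a (algebraMap R A) t hja hrel)
  refine ⟨σ, φ, hσ1, hφ1, ?_, ?_⟩
  · intro b
    have : (Polynomial.evalRingHom (1 : A)).comp φ = RingHom.id A := by
      apply hext
      · intro r
        rw [RingHom.comp_apply, hφ1]; simp
      · intro i
        rw [RingHom.comp_apply, hφ2]; simp
    exact RingHom.congr_fun this b
  · intro b
    have : (Polynomial.evalRingHom (0 : A)).comp φ = (algebraMap R A).comp σ := by
      apply hext
      · intro r
        rw [RingHom.comp_apply, RingHom.comp_apply, hφ1, hσ1]; simp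
      · intro i
        rw [RingHom.comp_apply, RingHom.comp_apply, hφ2, hσ2]; simp
    exact RingHom.congr_fun this b

/-- The contraction data on the forcing algebra of an element of the ideal. -/
theorem forcing_contraction {R : Type*} [CommRing R] {n : ℕ} (f : Fin n → R) (f₀ : R)
    (hf : f₀ ∈ Ideal.span (Set.range f)) :
    ∃ (σ : (MvPolynomial (Fin n) R ⧸ Ideal.span {forcingPoly R n f f₀}) →+* R)
      (φ : (MvPolynomial (Fin n) R ⧸ Ideal.span {forcingPoly R n f f₀}) →+*
        Polynomial (MvPolynomial (Fin n) R ⧸ Ideal.span {forcingPoly R n f f₀})),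
      (∀ r, σ (algebraMap R _ r) = r) ∧
      (∀ r, φ (algebraMap R _ r) = Polynomial.C (algebraMap R _ r)) ∧
      (∀ b, (φ b).eval 1 = b) ∧ (∀ b, (φ b).eval 0 = algebraMap R _ (σ b)) :=
  abstract_contraction f f₀ hf (fun i => Ideal.Quotient.mk _ (X i)) (forcing_rel f f₀)
    (fun S _ j s h => ⟨forcingLift f f₀ j s h, forcingLift_algebraMap f f₀ j s h,
      forcingLift_X f f₀ j s h⟩)
    (fun S _ _ _ h1 h2 => forcing_hom_ext h1 h2)

/-- Localizing contraction data. -/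
theorem conn_localization {R A : Type*} [CommRing R] [IsDomain R] [CommRing A] [Algebra R A]
    (σ : A →+* R) (φ : A →+* Polynomial A)
    (hσ : ∀ r, σ (algebraMap R _ r) = r)
    (hφ : ∀ r, φ (algebraMap R _ r) = Polynomial.C (algebraMap R _ r))
    (h1 : ∀ b, (φ b).eval 1 = b) (h0 : ∀ b, (φ b).eval 0 = algebraMap R _ (σ b))
    (p : Ideal R) [p.IsPrime] :
    ConnectedSpace (PrimeSpectrum (Localization (Submonoid.map
          (algebraMap R A) p.primeCompl))) := by
  let M := Submonoid.map (algebraMap R A) p.primeCompl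
  let L := Localization M
  let R' := Localization p.primeCompl
  have : IsDomain R' := IsLocalization.isDomain_localization p.primeCompl_le_nonZeroDivisors
  have hu : ∀ r ∈ p.primeCompl, IsUnit (algebraMap A L (algebraMap R A r)) := fun r hr =>
    IsLocalization.map_units (M := M) L ⟨_, ⟨r, hr, rfl⟩⟩
  let σ' : L →+* R' := IsLocalization.lift (M := M) (g := (algebraMap R R').comp σ) (by
    rintro ⟨_, r, hr, rfl⟩
    change IsUnit (algebraMap R R' (σ (algebraMap R A r)))
    rw [hσ]
    exact IsLocalization.map_units (M := p.primeCompl) R' ⟨r, hr⟩)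
  let ι' : R' →+* L := IsLocalization.lift (M := p.primeCompl)
    (g := (algebraMap A L).comp (algebraMap R A)) (fun y => hu y.1 y.2)
  let φ' : L →+* Polynomial L := IsLocalization.lift (M := M)
    (g := (Polynomial.mapRingHom (algebraMap A L)).comp φ) (by
    rintro ⟨_, r, hr, rfl⟩
    change IsUnit (Polynomial.map (algebraMap A L) (φ (algebraMap R A r)))
    rw [hφ, Polynomial.map_C]
    exact (hu r hr).map Polynomial.C)
  have hφ' : ∀ a, φ' (algebraMap A L a) = Polynomial.map (algebraMap A L) (φ a) := fun a =>
    IsLocalization.lift_eq _ _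
  have hσ' : ∀ a, σ' (algebraMap A L a) = algebraMap R R' (σ a) := fun a =>
    IsLocalization.lift_eq _ _
  have hι' : ∀ a, ι' (algebraMap R R' a) = algebraMap A L (algebraMap R A a) := fun a =>
    IsLocalization.lift_eq _ _
  refine conn_of_contraction σ' ι' φ' ?_ ?_
  · intro b
    have : (Polynomial.evalRingHom (1 : L)).comp φ' = RingHom.id L := by
      apply IsLocalization.ringHom_ext M
      ext a
      simp only [RingHom.comp_apply, hφ', Polynomial.coe_evalRingHom, RingHom.id_apply]
      rw [← map_one (algebraMap A L), Polynomial.eval_map_apply, h1]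
    exact RingHom.congr_fun this b
  · intro b
    have : (Polynomial.evalRingHom (0 : L)).comp φ' = ι'.comp σ' := by
      apply IsLocalization.ringHom_ext M
      ext a
      simp only [RingHom.comp_apply, hφ', Polynomial.coe_evalRingHom, hσ', hι']
      rw [← map_zero (algebraMap A L), Polynomial.eval_map_apply, h0]
    exact RingHom.congr_fun this b

theorem exists_loc_lift {R A K : Type*} [CommRing R] [CommRing A] [Algebra R A] [CommRing K]
    (p : Ideal R) [p.IsPrime] (α : A →+* K)
    (h : ∀ r, r ∉ p → IsUnit (α (algebraMap R A r))) :
    ∃ α' : Localization (Submonoid.map (algebraMap R A) p.primeCompl) →+* K,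
      ∀ a, α' (algebraMap A _ a) = α a :=
  ⟨IsLocalization.lift (M := Submonoid.map (algebraMap R A) p.primeCompl) (g := α) (by
      rintro ⟨_, r, hr, rfl⟩
      exact h r hr), fun _ => IsLocalization.lift_eq _ _⟩

/-- If `f₀` is in the radical but not in the ideal, there is a prime such that the spectrum of
every suitable localization of the forcing algebra is disconnected. -/
theorem forcing_not_conn {R : Type*} (K : Type*) [CommRing R] [IsDedekindDomain R]
    [Field K] [Algebra R K] [IsFractionRing R K]
    {n : ℕ} (f : Fin n → R) (f₀ : R)
    (hrad : f₀ ∈ (Ideal.span (Set.range f)).radical) (hf : f₀ ∉ Ideal.span (Set.range f)) :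
    ¬ ConnectedSpace
        (PrimeSpectrum (MvPolynomial (Fin n) R ⧸ Ideal.span {forcingPoly R n f f₀})) ∧
    ∃ (p : Ideal R) (_ : p.IsPrime),
      ¬ ConnectedSpace (PrimeSpectrum (Localization (Submonoid.map
          (algebraMap R (MvPolynomial (Fin n) R ⧸ Ideal.span {forcingPoly R n f f₀}))
          p.primeCompl))) := by
  classical
  obtain ⟨p, hpm, hp0, hIp, hf0p, c, hc, g, hg, hcf, N, J, hJ, hcJ⟩ :=
    dedekind_split_data f f₀ hrad hf
  have hf0 : f₀ ≠ 0 := fun h => hf (h ▸ Ideal.zero_mem _)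
  obtain ⟨i₀, hi₀⟩ : ∃ i, f i ≠ 0 := by
    by_contra! h
    obtain ⟨k, hk⟩ := hrad
    have hb : Ideal.span (Set.range f) = ⊥ := by
      rw [Ideal.span_eq_bot]
      rintro _ ⟨i, rfl⟩
      exact h i
    rw [hb, Ideal.mem_bot] at hk
    exact hf0 (eq_zero_of_pow_eq_zero hk)
  let A := MvPolynomial (Fin n) R ⧸ Ideal.span {forcingPoly R n f f₀}
  let k := algebraMap R K
  have hk : Function.Injective k := IsFractionRing.injective R K
  have hk0 : k (f i₀) ≠ 0 := fun h => hi₀ (hk (by simpa using h))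
  let α : A →+* K := forcingLift f f₀ k (fun i => if i = i₀ then - k f₀ / k (f i₀) else 0) (by
    simp only [mul_ite, mul_zero, Finset.sum_ite_eq', Finset.mem_univ, if_true]
    field_simp
    ring)
  have hαj : ∀ r, α (algebraMap R A r) = k r := fun r => forcingLift_algebraMap ..
  let _ : Field (R ⧸ p) := Ideal.Quotient.field p
  let β : A →+* R ⧸ p := forcingLift f f₀ (Ideal.Quotient.mk p) 0 (by
    simpa using Ideal.Quotient.eq_zero_iff_mem.mpr hf0p)
  have hβj : ∀ r, β (algebraMap R A r) = Ideal.Quotient.mk p r :=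
    fun r => forcingLift_algebraMap ..
  refine ⟨?_, p, hpm.isPrime, ?_⟩
  · refine not_conn_of_split f f₀ (algebraMap R A) _ (forcing_rel f f₀) p hp0 c hc g hg hcf
      N J hJ hcJ α ?_ β ?_
    · intro x y hxy
      exact hk (by simpa [hαj] using hxy)
    · intro a ha
      rw [hβj]; exact Ideal.Quotient.eq_zero_iff_mem.mpr ha
  · have hpp := hpm.isPrime
    let M := Submonoid.map (algebraMap R A) p.primeCompl
    let L := Localization M
    obtain ⟨α', hα'⟩ : ∃ α' : L →+* K, ∀ a, α' (algebraMap A L a) = α a := by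
      refine exists_loc_lift p α fun r hr => ?_
      rw [hαj, isUnit_iff_ne_zero]
      intro h
      have : r = 0 := hk (by simpa using h)
      exact hr (this ▸ p.zero_mem)
    obtain ⟨β', hβ'⟩ : ∃ β' : L →+* R ⧸ p, ∀ a, β' (algebraMap A L a) = β a := by
      refine exists_loc_lift p β fun r hr => ?_
      rw [hβj]
      refine IsUnit.mk0 _ ?_
      intro h
      exact hr (Ideal.Quotient.eq_zero_iff_mem.mp h)
    refine not_conn_of_split (B := L) f f₀ ((algebraMap A L).comp (algebraMap R A))
      (fun i => algebraMap A L (Ideal.Quotient.mk _ (X i))) ?_ p hp0 c hc g hg hcf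
      N J hJ hcJ α' ?_ β' ?_
    · have := congrArg (algebraMap A L) (forcing_rel f f₀)
      rw [map_add, map_sum, map_zero] at this
      simp only [map_mul] at this
      exact this
    · intro x y hxy
      simp only [RingHom.comp_apply, hα', hαj] at hxy
      exact hk hxy
    · intro a ha
      rw [RingHom.comp_apply, hβ', hβj]; exact Ideal.Quotient.eq_zero_iff_mem.mpr ha

/-- Corollary `dedekind`: Let `R` be a Dedekind domain (a normal, i.e.
integrally closed, noetherian domain of Krull dimension `1`), `I = (f_1,…,f_n)` an ideal,
`f₀` an element of the radical of `I`, and `A = R[T_1,…,T_n]/(f_1T_1+⋯+f_nT_n+f₀)` the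
forcing algebra. Then the following are equivalent: (1) `Spec A` is connected; (2) for
every prime `𝔭` of `R`, `Spec A_{R∖𝔭}` is connected; (3) `f₀ ∈ I`. -/
theorem dedekind_forcing_algebra_connected_iff_mem
    (R : Type*) [CommRing R] [IsDomain R] [IsNoetherianRing R] [IsIntegrallyClosed R]
    (hdim : ringKrullDim R = 1)
    (n : ℕ) (f : Fin n → R) (f₀ : R)
    (hrad : f₀ ∈ (Ideal.span (Set.range f)).radical) :
    List.TFAE
      [ConnectedSpace
        (PrimeSpectrum (MvPolynomial (Fin n) R ⧸ Ideal.span {forcingPoly R n f f₀})),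
       ∀ (p : Ideal R) [p.IsPrime],
        ConnectedSpace (PrimeSpectrum (Localization (Submonoid.map
          (algebraMap R (MvPolynomial (Fin n) R ⧸ Ideal.span {forcingPoly R n f f₀}))
          p.primeCompl))),
       f₀ ∈ Ideal.span (Set.range f)] := by
  have hK : Ring.KrullDimLE 1 R := by
    rw [Ring.krullDimLE_iff, hdim]; rfl
  have hD : Ring.DimensionLEOne R :=
    ⟨fun h0 h1 => Ring.krullDimLE_one_iff_of_noZeroDivisors.mp hK _ h0 h1⟩
  have hR : IsDedekindRing R := { }
  have hDD : IsDedekindDomain R := { }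
  tfae_have 1 → 3 := by
    intro h
    by_contra hf
    exact (forcing_not_conn (FractionRing R) f f₀ hrad hf).1 h
  tfae_have 2 → 3 := by
    intro h
    by_contra hf
    obtain ⟨p, hp, hn⟩ := (forcing_not_conn (FractionRing R) f f₀ hrad hf).2
    exact hn (h p)
  tfae_have 3 → 1 := by
    intro h
    obtain ⟨σ, φ, _, _, h1, h0⟩ := forcing_contraction f f₀ h
    exact conn_of_contraction σ _ φ h1 h0
  tfae_have 3 → 2 := by
    intro h p _
    obtain ⟨σ, φ, hσ, hφ, h1, h0⟩ := forcing_contraction f f₀ h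
    exact conn_localization σ φ hσ hφ h1 h0 p
  tfae_finish
end

section
/- Let R be a noetherian integral domain with fraction field K = Q(R), let r, s ∈ R with s ≠ 0, let A = R[T]/(sT+r) be the forcing algebra and φ : Spec A → Spec R the forcing morphism. Then the element r/s ∈ K is integral over R if and only if φ is universally connected, i.e. for every noetherian commutative R-algebra W with Spec W connected, Spec(W ⊗_R A) is connected. -/
open TensorProduct Polynomial

universe u

/-- `B` is the forcing algebra over `W` for `σ, ρ`, with `t` the class of the variable. -/
structure IsForcingAlg (W B : Type u) [CommRing W] [CommRing B] [Algebra W B]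
    (σ ρ : W) (t : B) : Prop where
  rel : algebraMap W B σ * t + algebraMap W B ρ = 0
  surj : ∀ b : B, ∃ f : W[X], aeval t f = b
  lift : ∀ (C : Type u) [CommRing C] [Algebra W C] (c : C),
    algebraMap W C σ * c + algebraMap W C ρ = 0 → ∃ g : B →ₐ[W] C, g t = c

theorem isForcingAlg_tensor (R W : Type u) [CommRing R] [CommRing W] [Algebra R W] (r s : R) :
    IsForcingAlg W (W ⊗[R] (Polynomial R ⧸ Ideal.span {(C s * X + C r : Polynomial R)}))
      (algebraMap R W s) (algebraMap R W r)
      (1 ⊗ₜ (Ideal.Quotient.mk _ X)) := by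
  refine ⟨?_, ?_, ?_⟩
  · rw [← IsScalarTower.algebraMap_apply, ← IsScalarTower.algebraMap_apply,
      ← Algebra.smul_def, Algebra.algebraMap_eq_smul_one, Algebra.TensorProduct.one_def,
      ← TensorProduct.tmul_smul, ← TensorProduct.tmul_smul, ← TensorProduct.tmul_add]
    have : s • (Ideal.Quotient.mk (Ideal.span {(C s * X + C r : Polynomial R)}) X) +
        r • (1 : Polynomial R ⧸ Ideal.span {(C s * X + C r : Polynomial R)}) = 0 := by
      rw [← map_one (Ideal.Quotient.mk (Ideal.span {(C s * X + C r : Polynomial R)}))]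
      have e : (Ideal.Quotient.mk (Ideal.span {(C s * X + C r : Polynomial R)}))
        (s • X + r • 1) = 0 := by
        rw [Ideal.Quotient.eq_zero_iff_mem]
        apply Ideal.subset_span
        simp [smul_eq_C_mul]
      exact e
    rw [this, TensorProduct.tmul_zero]
  · intro b
    induction b using TensorProduct.induction_on with
    | zero => exact ⟨0, by simp⟩
    | add x y hx hy =>
      obtain ⟨f, rfl⟩ := hx
      obtain ⟨g, rfl⟩ := hy
      exact ⟨f + g, by simp⟩
    | tmul w a =>
      obtain ⟨p, rfl⟩ := Ideal.Quotient.mk_surjective a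
      refine ⟨C w * p.map (algebraMap R W), ?_⟩
      rw [map_mul, aeval_C, aeval_map_algebraMap]
      have h : aeval ((1 : W) ⊗ₜ[R] (Ideal.Quotient.mk
          (Ideal.span {(C s * X + C r : Polynomial R)}) X)) p =
          (Algebra.TensorProduct.includeRight : _ →ₐ[R] W ⊗[R] _)
            (Ideal.Quotient.mk (Ideal.span {(C s * X + C r : Polynomial R)}) p) := by
        have : aeval ((1 : W) ⊗ₜ[R] (Ideal.Quotient.mk
          (Ideal.span {(C s * X + C r : Polynomial R)}) X)) =
          (Algebra.TensorProduct.includeRight : _ →ₐ[R] W ⊗[R] _).comp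
            (Ideal.Quotient.mkₐ R (Ideal.span {(C s * X + C r : Polynomial R)})) := by
          ext
          simp
        rw [this]
        rfl
      rw [h]
      simp [Algebra.TensorProduct.algebraMap_apply]
  · intro D _ _ c hc
    let _ : Algebra R D := ((algebraMap W D).comp (algebraMap R W)).toAlgebra
    have : IsScalarTower R W D := IsScalarTower.of_algebraMap_eq' rfl
    let g₁ : (Polynomial R ⧸ Ideal.span {(C s * X + C r : Polynomial R)}) →ₐ[R] D :=
      Ideal.Quotient.liftₐ _ (aeval c) (by
        intro a ha
        have : Ideal.span {(C s * X + C r : Polynomial R)} ≤ RingHom.ker (aeval (R := R) c) := by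
          rw [Ideal.span_le, Set.singleton_subset_iff]
          simpa [RingHom.mem_ker, IsScalarTower.algebraMap_apply R W D] using hc
        exact this ha)
    refine ⟨Algebra.TensorProduct.lift (Algebra.ofId W D) g₁ (fun _ _ => Commute.all _ _), ?_⟩
    simp only [Algebra.TensorProduct.lift_tmul, map_one, one_mul]
    exact aeval_X c

theorem eval_map_scale {W k : Type u} [CommRing W] [Field k] [Algebra W k] {σ ρ : W} {P : W[X]}
    (hP : eval (-ρ) (scaleRoots P σ) = 0) (c : k)
    (hc : algebraMap W k σ * c + algebraMap W k ρ = 0) (h0 : algebraMap W k σ ≠ 0) :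
    aeval c P = 0 := by
  have h := scaleRoots_eval₂_mul (p := P) (algebraMap W k) c σ
  have e : algebraMap W k σ * c = algebraMap W k (-ρ) := by
    rw [map_neg]; exact eq_neg_of_add_eq_zero_left hc
  rw [e, eval₂_at_apply, hP, map_zero] at h
  exact (mul_eq_zero.mp h.symm).resolve_left (pow_ne_zero _ h0)

theorem map_rho_zero {W D : Type u} [CommRing W] [CommRing D] [IsDomain D] [Algebra W D]
    {σ ρ : W} {P : W[X]} (hm : P.Monic)
    (hP : eval (-ρ) (scaleRoots P σ) = 0) (h0 : algebraMap W D σ = 0) :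
    algebraMap W D ρ = 0 := by
  have h : eval₂ (algebraMap W D) (algebraMap W D (-ρ)) (scaleRoots P σ) = 0 := by
    rw [eval₂_at_apply, hP, map_zero]
  rw [← eval_map, map_scaleRoots _ _ _ (by simp [hm.leadingCoeff]), h0, scaleRoots_zero] at h
  simp only [hm.map _ |>.leadingCoeff, one_smul, eval_pow, eval_X, map_neg] at h
  exact neg_eq_zero.mp (by
    by_contra h1
    exact pow_ne_zero _ h1 h)

theorem forcing_connected {W B : Type u} [CommRing W] [CommRing B] [Algebra W B]
    {σ ρ : W} {t : B} (hB : IsForcingAlg W B σ ρ t) {P : W[X]} (hm : P.Monic)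
    (hd : P.natDegree ≠ 0)
    (hP : eval (-ρ) (scaleRoots P σ) = 0) [ConnectedSpace (PrimeSpectrum W)] :
    ConnectedSpace (PrimeSpectrum B) := by
  let f : PrimeSpectrum B → PrimeSpectrum W := PrimeSpectrum.comap (algebraMap W B)
  have hfc : Continuous f := PrimeSpectrum.continuous_comap _
  -- quotient map
  have hq : Topology.IsQuotientMap f := by
    let J : Ideal B := Ideal.span {aeval t P}
    let i : PrimeSpectrum (B ⧸ J) → PrimeSpectrum B := PrimeSpectrum.comap (Ideal.Quotient.mk J)
    have hic : Continuous i := PrimeSpectrum.continuous_comap _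
    have hcomp : f ∘ i = PrimeSpectrum.comap (algebraMap W (B ⧸ J)) := rfl
    refine Topology.IsQuotientMap.of_comp hic hfc ?_
    rw [hcomp]
    refine IsClosedMap.isQuotientMap ?_ (PrimeSpectrum.continuous_comap _) ?_
    · apply PrimeSpectrum.isClosedMap_comap_of_isIntegral
      intro x
      obtain ⟨b, rfl⟩ := Ideal.Quotient.mk_surjective x
      obtain ⟨g, rfl⟩ := hB.surj b
      change IsIntegral W _
      have ht : IsIntegral W (Ideal.Quotient.mkₐ W J t) := by
        refine ⟨P, hm, ?_⟩
        rw [← aeval_def, aeval_algHom_apply]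
        exact Ideal.Quotient.eq_zero_iff_mem.mpr (Ideal.subset_span rfl)
      have : Ideal.Quotient.mk J (aeval t g) = aeval (Ideal.Quotient.mkₐ W J t) g := by
        rw [aeval_algHom_apply]; rfl
      rw [this]
      exact IsIntegral.of_mem_of_fg _ ht.fg_adjoin_singleton _ (aeval_mem_adjoin_singleton _ _)
    · intro p
      let k := AlgebraicClosure p.asIdeal.ResidueField
      have hk : RingHom.ker (algebraMap W k) = p.asIdeal := by
        rw [IsScalarTower.algebraMap_eq W p.asIdeal.ResidueField k,
          RingHom.ker_comp_of_injective _ (algebraMap p.asIdeal.ResidueField k).injective,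
          Ideal.ker_algebraMap_residueField]
      obtain ⟨c, hc, hPc⟩ : ∃ c : k, algebraMap W k σ * c + algebraMap W k ρ = 0 ∧
          aeval c P = 0 := by
        by_cases h0 : algebraMap W k σ = 0
        · have hr := map_rho_zero hm hP h0
          obtain ⟨c, hc⟩ := IsAlgClosed.exists_root (P.map (algebraMap W k)) (by
            rw [hm.degree_map]
            intro h
            exact hd (natDegree_eq_of_degree_eq_some h))
          refine ⟨c, by simp [h0, hr], ?_⟩
          rw [aeval_def, ← eval_map]; exact hc
        · have : algebraMap W k σ * (-(algebraMap W k ρ) / algebraMap W k σ) +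
            algebraMap W k ρ = 0 := by
            rw [mul_div_cancel₀ _ h0, neg_add_cancel]
          exact ⟨_, this, eval_map_scale hP _ this h0⟩
      obtain ⟨g, rfl⟩ := hB.lift k c hc
      have hg : ∀ a ∈ J, g a = 0 := by
        intro a ha
        have : J ≤ RingHom.ker g := by
          rw [Ideal.span_le, Set.singleton_subset_iff]
          change g _ = 0
          rw [← aeval_algHom_apply]; exact hPc
        exact this ha
      let g' : (B ⧸ J) →ₐ[W] k := Ideal.Quotient.liftₐ J g hg
      refine ⟨⟨RingHom.ker g', RingHom.ker_isPrime _⟩, ?_⟩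
      ext w
      refine Iff.trans ?_ (iff_of_eq (congrArg (fun I => w ∈ I) hk))
      simp [RingHom.mem_ker]
  -- saturated
  have hsat : ∀ U : Set (PrimeSpectrum B), IsClopen U → ∀ q q' : PrimeSpectrum B,
      f q = f q' → q ∈ U → q' ∈ U := by
    intro U hU q q' hqq hqU
    have hmem : ∀ w : W, algebraMap W B w ∈ q.asIdeal ↔ algebraMap W B w ∈ q'.asIdeal := by
      intro w
      have := congrArg (fun x => w ∈ x.asIdeal) hqq
      exact iff_of_eq this
    by_cases hσ : algebraMap W B σ ∈ q.asIdeal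
    · let p := (f q).asIdeal
      let D := (W ⧸ p)[X]
      have h0 : algebraMap W (W ⧸ p) σ = 0 := Ideal.Quotient.eq_zero_iff_mem.mpr hσ
      have hr : algebraMap W (W ⧸ p) ρ = 0 := map_rho_zero hm hP h0
      obtain ⟨g, hg⟩ := hB.lift D X (by
        rw [IsScalarTower.algebraMap_apply W (W ⧸ p) D, IsScalarTower.algebraMap_apply W (W ⧸ p) D,
          h0, hr]; simp)
      let Q : PrimeSpectrum B := ⟨RingHom.ker g, RingHom.ker_isPrime _⟩
      have key : ∀ z : PrimeSpectrum B, (∀ w ∈ p, algebraMap W B w ∈ z.asIdeal) → Q ⤳ z := by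
        intro z hz
        rw [← PrimeSpectrum.le_iff_specializes]
        intro b hb
        obtain ⟨F, rfl⟩ := hB.surj b
        have hb' : g (aeval t F) = 0 := hb
        rw [← aeval_algHom_apply, hg] at hb'
        have hF : F.map (algebraMap W (W ⧸ p)) = 0 := by
          rw [← hb', ← aeval_map_algebraMap (W ⧸ p), aeval_X_left_apply]
        rw [aeval_eq_sum_range]
        refine Ideal.sum_mem _ fun n _ => ?_
        rw [Algebra.smul_def]
        refine Ideal.mul_mem_right _ _ (hz _ ?_)
        rw [← Ideal.Quotient.eq_zero_iff_mem]
        have := congrArg (fun x => coeff x n) hF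
        simpa using this
      have h1 : Q ∈ U := (key q fun w hw => hw).mem_open hU.isOpen hqU
      exact (key q' fun w hw => (hmem w).mp hw).mem_closed hU.isClosed h1
    · have hσ' : algebraMap W B σ ∉ q'.asIdeal := fun h => hσ ((hmem σ).mpr h)
      have : q = q' := by
        have key : ∀ F : W[X], ∃ (n : ℕ) (w : W),
            algebraMap W B σ ^ n * aeval t F = algebraMap W B w := by
          intro F
          refine ⟨F.natDegree, eval (-ρ) (scaleRoots F σ), ?_⟩
          have h := scaleRoots_eval₂_mul (p := F) (algebraMap W B) t σ
          have e : algebraMap W B σ * t = algebraMap W B (-ρ) := by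
            rw [map_neg]; exact eq_neg_of_add_eq_zero_left hB.rel
          rw [e, eval₂_at_apply] at h
          exact h.symm
        ext b
        obtain ⟨F, rfl⟩ := hB.surj b
        obtain ⟨n, w, h⟩ := key F
        have aux : ∀ z : PrimeSpectrum B, algebraMap W B σ ∉ z.asIdeal →
            (aeval t F ∈ z.asIdeal ↔ algebraMap W B w ∈ z.asIdeal) := by
          intro z hz
          rw [← h]
          exact ⟨fun h => Ideal.mul_mem_left _ _ h, fun h =>
            (z.isPrime.mem_or_mem h).resolve_left fun h' => hz (z.isPrime.mem_of_pow_mem _ h')⟩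
        rw [aux q hσ, aux q' hσ', hmem]
      exact this ▸ hqU
  have : Nonempty (PrimeSpectrum B) := by
    obtain ⟨p⟩ := (inferInstance : Nonempty (PrimeSpectrum W))
    obtain ⟨q, _⟩ := hq.surjective p
    exact ⟨q⟩
  have : PreconnectedSpace (PrimeSpectrum B) := by
    rw [preconnectedSpace_iff_clopen]
    intro U hU
    have hpre : f ⁻¹' (f '' U) = U := by
      apply Set.Subset.antisymm
      · rintro q' ⟨q, hqU, hqq⟩
        exact hsat U hU q q' hqq hqU
      · exact Set.subset_preimage_image f U
    have hcl : IsClopen (f '' U) := by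
      rw [← hq.isClopen_preimage, hpre]; exact hU
    rcases isClopen_iff.mp hcl with h | h
    · left; rw [← hpre, h, Set.preimage_empty]
    · right; rw [← hpre, h, Set.preimage_univ]
  exact ⟨inferInstance⟩

theorem integral_of_mem_adjoin_inv {R K : Type u} [CommRing R] [Field K] [Algebra R K]
    {y x : K} (hxy : y * x = 1) (h : x ∈ Algebra.adjoin R {y}) : IsIntegral R x := by
  rw [Algebra.adjoin_singleton_eq_range_aeval] at h
  obtain ⟨F, hF⟩ := h
  have hF : aeval y F = x := hF
  let _ : Invertible y := ⟨x, by rw [mul_comm]; exact hxy, hxy⟩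
  have e := eval₂_reverse_mul_pow (algebraMap R K) y F
  rw [← aeval_def y, hF] at e
  have e : eval₂ (algebraMap R K) x F.reverse * y ^ F.natDegree = x := e
  refine ⟨X ^ (F.natDegree + 1) - F.reverse, monic_X_pow_sub ?_, ?_⟩
  · refine lt_of_le_of_lt degree_le_natDegree ?_
    exact_mod_cast Nat.lt_succ_of_le (reverse_natDegree_le F)
  · rw [eval₂_sub, eval₂_X_pow, sub_eq_zero, pow_succ]
    have : x ^ F.natDegree * x =
      eval₂ (algebraMap R K) x F.reverse * (y * x) ^ F.natDegree := by
      rw [mul_pow]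
      calc _ = x ^ F.natDegree * (eval₂ (algebraMap R K) x F.reverse * y ^ F.natDegree) := by
            rw [e]
        _ = _ := by ring
    rw [this, hxy]; simp

/-- A one-dimensional local situation in which the forcing algebra is disconnected. -/
theorem forcing_disconnected {W B : Type u} [CommRing W] [CommRing B] [Algebra W B]
    [IsDomain W] {y ρ : W} {t : B} (hB : IsForcingAlg W B (y * ρ) ρ t) (hy : y ≠ 0)
    (m : Ideal W) (hm : m.IsPrime) (hρm : ρ ∈ m)
    (hp : ∀ p : Ideal W, p.IsPrime → ρ ∈ p → y ∈ p) (hρ : ρ ≠ 0) :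
    ¬ ConnectedSpace (PrimeSpectrum B) := by
  intro hc
  let U : Set (PrimeSpectrum B) := PrimeSpectrum.zeroLocus {algebraMap W B ρ}
  let V : Set (PrimeSpectrum B) := PrimeSpectrum.zeroLocus {algebraMap W B y * t + 1}
  have hprod : algebraMap W B ρ * (algebraMap W B y * t + 1) = 0 := by
    have := hB.rel
    rw [map_mul] at this
    linear_combination this
  have hUV : Uᶜ = V := by
    ext q
    simp only [U, V, Set.mem_compl_iff, PrimeSpectrum.mem_zeroLocus, Set.singleton_subset_iff,
      SetLike.mem_coe]
    constructor
    · intro h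
      exact (q.isPrime.mem_or_mem (hprod ▸ q.asIdeal.zero_mem)).resolve_left h
    · intro h h'
      have : y ∈ q.asIdeal.comap (algebraMap W B) := hp _ (Ideal.IsPrime.comap _) h'
      refine q.isPrime.ne_top ((Ideal.eq_top_iff_one _).mpr ?_)
      have h2 := q.asIdeal.sub_mem h (q.asIdeal.mul_mem_right t this)
      simpa using h2
  have hU : IsClopen U := by
    refine ⟨PrimeSpectrum.isClosed_zeroLocus _, ?_⟩
    rw [← isClosed_compl_iff, hUV]
    exact PrimeSpectrum.isClosed_zeroLocus _
  obtain ⟨g₁, hg₁⟩ := hB.lift (W ⧸ m) 0 (by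
    rw [mul_zero, zero_add]; exact Ideal.Quotient.eq_zero_iff_mem.mpr hρm)
  let L := FractionRing W
  have hyL : algebraMap W L y ≠ 0 := by simpa using hy
  have hρL : algebraMap W L ρ ≠ 0 := by simpa using hρ
  obtain ⟨g₂, hg₂⟩ := hB.lift L (-(algebraMap W L y)⁻¹) (by
    rw [map_mul]
    have := mul_inv_cancel₀ hyL
    linear_combination (-(algebraMap W L ρ)) * this)
  let q₁ : PrimeSpectrum B := ⟨RingHom.ker g₁, RingHom.ker_isPrime _⟩
  let q₂ : PrimeSpectrum B := ⟨RingHom.ker g₂, RingHom.ker_isPrime _⟩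
  have h1 : q₁ ∈ U := by
    simp only [U, PrimeSpectrum.mem_zeroLocus, Set.singleton_subset_iff, SetLike.mem_coe]
    change g₁ _ = 0
    rw [g₁.commutes]
    exact Ideal.Quotient.eq_zero_iff_mem.mpr hρm
  have h2 : q₂ ∉ U := by
    simp only [U, PrimeSpectrum.mem_zeroLocus, Set.singleton_subset_iff, SetLike.mem_coe]
    change ¬ g₂ _ = 0
    rw [g₂.commutes]
    exact hρL
  rcases isClopen_iff.mp hU with h | h
  · rw [h] at h1; exact h1
  · rw [h] at h2; exact h2 trivial

theorem spec_domain_connected (W : Type u) [CommRing W] [IsDomain W] :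
    ConnectedSpace (PrimeSpectrum W) := inferInstance

theorem forcing_empty {k B : Type u} [Field k] [CommRing B] [Algebra k B]
    {σ ρ : k} {t : B} (hB : IsForcingAlg k B σ ρ t) (hσ : σ = 0) (hρ : ρ ≠ 0) :
    ¬ ConnectedSpace (PrimeSpectrum B) := by
  intro hc
  obtain ⟨q⟩ := hc.toNonempty
  have hrel := hB.rel
  rw [hσ, map_zero, zero_mul, zero_add] at hrel
  have hu := (IsUnit.mk0 _ hρ).map (algebraMap k B)
  rw [hrel] at hu
  exact q.isPrime.ne_top (Ideal.eq_top_of_isUnit_mem _ q.asIdeal.zero_mem hu)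

theorem fraction_integral_iff_forcing_universally_connected
    (R : Type u) [CommRing R] [IsDomain R] [IsNoetherianRing R]
    (r s : R) (hs : s ≠ 0) :
    IsIntegral R
        (algebraMap R (FractionRing R) r / algebraMap R (FractionRing R) s) ↔
      ∀ (W : Type u) [CommRing W] [Algebra R W] [IsNoetherianRing W],
        ConnectedSpace (PrimeSpectrum W) →
          ConnectedSpace (PrimeSpectrum
            (W ⊗[R] (Polynomial R ⧸ Ideal.span {(C s * X + C r : Polynomial R)}))) := by
  have hsK : algebraMap R (FractionRing R) s ≠ 0 := by simpa using hs
  constructor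
  · intro hint W _ _ _ hW
    obtain ⟨P, hm, hP⟩ := hint.neg
    have hsc : eval (-r) (scaleRoots P s) = 0 := by
      apply IsFractionRing.injective R (FractionRing R)
      have h := scaleRoots_eval₂_eq_zero (algebraMap R (FractionRing R)) (s := s) hP
      have e : algebraMap R (FractionRing R) s * -(algebraMap R (FractionRing R) r /
          algebraMap R (FractionRing R) s) = algebraMap R (FractionRing R) (-r) := by
        rw [mul_neg, mul_div_cancel₀ _ hsK, map_neg]
      rw [e, eval₂_at_apply] at h
      rw [h, map_zero]
    have hd : P.natDegree ≠ 0 := by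
      intro h
      rw [hm.natDegree_eq_zero.mp h] at hP
      simp at hP
    have : Nontrivial W := by
      obtain ⟨p⟩ := (inferInstance : Nonempty (PrimeSpectrum W))
      exact p.nontrivial
    refine forcing_connected (isForcingAlg_tensor R W r s) (hm.map (algebraMap R W))
      (by rwa [hm.natDegree_map]) ?_
    rw [← map_scaleRoots _ _ _ (by simp [hm.leadingCoeff]), ← map_neg, eval_map, eval₂_at_apply,
      hsc, map_zero]
  · intro H
    by_contra hint
    have hr : r ≠ 0 := by
      rintro rfl
      apply hint
      simpa using isIntegral_zero
    have hrK : algebraMap R (FractionRing R) r ≠ 0 := by simpa using hr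
    let y : FractionRing R := algebraMap R (FractionRing R) s / algebraMap R (FractionRing R) r
    let S := Algebra.adjoin R {y}
    let yS : S := ⟨y, Algebra.subset_adjoin rfl⟩
    have hyr : yS * algebraMap R S r = algebraMap R S s := by
      apply Subtype.ext
      exact div_mul_cancel₀ _ hrK
    have hrS : algebraMap R S r ≠ 0 := fun h => hrK (congrArg Subtype.val h)
    have hsS : algebraMap R S s ≠ 0 := fun h => hsK (congrArg Subtype.val h)
    have hyS0 : yS ≠ 0 := by
      intro h; rw [h, zero_mul] at hyr; exact hsS hyr.symm
    have : Algebra.FiniteType R S :=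
      Subalgebra.fg_iff_finiteType _ |>.mp ⟨{y}, by simp [S]⟩
    have : IsNoetherianRing S := Algebra.FiniteType.isNoetherianRing R S
    have hyu : ¬ IsUnit yS := by
      intro hu
      obtain ⟨z, hz⟩ := hu.exists_right_inv
      apply hint
      have hz' : y * (z : FractionRing R) = 1 := congrArg Subtype.val hz
      have : (z : FractionRing R) =
          algebraMap R (FractionRing R) r / algebraMap R (FractionRing R) s := by
        rw [eq_div_iff hsK]
        have e : y * algebraMap R (FractionRing R) r = algebraMap R (FractionRing R) s :=
          div_mul_cancel₀ _ hrK
        rw [← e]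
        linear_combination (algebraMap R (FractionRing R) r) * hz'
      rw [← this]
      exact integral_of_mem_adjoin_inv hz' z.2
    obtain ⟨p, hp⟩ := Ideal.nonempty_minimalPrimes
      (show Ideal.span {yS} ≠ ⊤ by rwa [Ne, Ideal.span_singleton_eq_top])
    have hpp : p.IsPrime := hp.1.1
    have hyp : yS ∈ p := hp.1.2 (Ideal.subset_span rfl)
    have hht : p.height ≤ 1 :=
      Ideal.height_le_one_of_isPrincipal_of_mem_minimalPrimes (Ideal.span {yS}) p hp
    by_cases hrp : algebraMap R S r ∈ p
    · let W := Localization.AtPrime p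
      have hinj : Function.Injective (algebraMap S W) :=
        IsLocalization.injective W p.primeCompl_le_nonZeroDivisors
      have : IsDomain W := IsLocalization.isDomain_of_le_nonZeroDivisors _ p.primeCompl_le_nonZeroDivisors
      have : IsNoetherianRing W := IsLocalization.isNoetherianRing p.primeCompl W inferInstance
      have hB := isForcingAlg_tensor R W r s
      have hc := H W (spec_domain_connected W)
      rw [IsScalarTower.algebraMap_apply R S W s, IsScalarTower.algebraMap_apply R S W r,
        ← hyr, map_mul] at hB
      refine forcing_disconnected hB ?_ (IsLocalRing.maximalIdeal W) inferInstance ?_ ?_ ?_ hc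
      · exact fun h => hyS0 (hinj (h.trans (map_zero _).symm))
      · rw [IsLocalization.AtPrime.to_map_mem_maximal_iff W p]
        exact hrp
      · intro Q hQ hrQ
        have hQ' : (Q.comap (algebraMap S W)).IsPrime := Ideal.IsPrime.comap _
        have hle : Q.comap (algebraMap S W) ≤ p := by
          intro a ha
          rw [← IsLocalization.AtPrime.to_map_mem_maximal_iff W p]
          exact IsLocalRing.le_maximalIdeal hQ.ne_top ha
        have heq : Q.comap (algebraMap S W) = p := by
          by_contra hne
          have hlt := lt_of_le_of_ne hle hne
          have h1 := Ideal.height_add_one_le_of_lt_of_isPrime hlt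
          have h0 : (Q.comap (algebraMap S W)).height ≠ 0 := by
            rw [Ne, Ideal.height_eq_zero_iff_eq_bot]
            intro h
            have : algebraMap R S r ∈ Q.comap (algebraMap S W) := hrQ
            rw [h] at this
            exact hrS this
          have h2 := h1.trans hht
          have h3 : (Q.comap (algebraMap S W)).height + 1 ≤ 0 + 1 := by simpa using h2
          exact h0 (nonpos_iff_eq_zero.mp ((ENat.add_le_add_iff_right (by simp)).mp h3))
        have : yS ∈ Q.comap (algebraMap S W) := by rw [heq]; exact hyp
        exact this
      · exact fun h => hrS (hinj (h.trans (map_zero _).symm))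
    · let k := p.ResidueField
      have hs0 : algebraMap R k s = 0 := by
        rw [IsScalarTower.algebraMap_apply R S k, ← hyr, map_mul,
          Ideal.algebraMap_residueField_eq_zero.mpr hyp, zero_mul]
      have hr0 : algebraMap R k r ≠ 0 := by
        rw [IsScalarTower.algebraMap_apply R S k, Ne, Ideal.algebraMap_residueField_eq_zero]
        exact hrp
      exact forcing_empty (isForcingAlg_tensor R k r s) hs0 hr0 (H k (spec_domain_connected k))
end
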